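/- Suppose (W,S) is a universal Coxeter system, i.e. s·t has infinite order for all distinct s, t ∈ S. Let θ : W → W be a group automorphism mapping S onto itself with θ ∘ θ = id, and let 𝒦 ⊆ W be a θ-twisted conjugacy class such that θ(x) = x⁻¹ for every x ∈ 𝒦. Then 𝒦 is quasiparabolic. -/

import Mathlib

noncomputable section

variable {B W : Type*} [Group W] {M : CoxeterMatrix B}

/-- The `θ`-twisted conjugation action of `W` on itself: `w • x = w·x·θ(w)⁻¹`. -/
def twConj (θ : W ≃* W) (w x : W) : W := w * x * (θ w)⁻¹

/-- The height function `ht = ℓ/2` on `W`. -/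
def htL (cs : CoxeterSystem M W) (x : W) : ℚ := (cs.length x : ℚ) / 2

/-- `𝒦` is a `θ`-twisted conjugacy class, i.e. an orbit of the twisted conjugation action. -/
def IsTwClass (θ : W ≃* W) (𝒦 : Set W) : Prop :=
  ∃ x₀ : W, 𝒦 = Set.range fun w => twConj θ w x₀

/-- The `θ`-twisted conjugacy class `𝒦` is quasiparabolic with respect to the height
function `ht = ℓ/2`: (QP1) and (QP2) hold. -/
def IsQPClass (cs : CoxeterSystem M W) (θ : W ≃* W) (𝒦 : Set W) : Prop :=
  (∀ r : W, cs.IsReflection r → ∀ x ∈ 𝒦,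
      htL cs (twConj θ r x) = htL cs x → twConj θ r x = x) ∧
  (∀ r : W, cs.IsReflection r → ∀ x ∈ 𝒦, ∀ i : B,
      htL cs x < htL cs (twConj θ r x) →
      htL cs (twConj θ (cs.simple i) (twConj θ r x)) < htL cs (twConj θ (cs.simple i) x) →
      twConj θ r x = twConj θ (cs.simple i) x)

/-- `x` is a `W`-minimal element: `ℓ(s·x·θ(s)⁻¹) ≥ ℓ(x)` for all simple reflections `s`. -/
def TwMin (cs : CoxeterSystem M W) (θ : W ≃* W) (x : W) : Prop :=
  ∀ i : B, cs.length x ≤ cs.length (twConj θ (cs.simple i) x)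

/-- The automorphism `θ` maps the set `S` of simple reflections onto itself. -/
def SimpleOnto (cs : CoxeterSystem M W) (θ : W ≃* W) : Prop :=
  ⇑θ '' Set.range cs.simple = Set.range cs.simple

theorem CoxeterMatrix.isLiftable_of_universal {G : Type*} [Monoid G]
    (huniv : ∀ i j : B, i ≠ j → M.M i j = 0) {f : B → G} (hf : ∀ i, f i * f i = 1) :
    M.IsLiftable f := by
  intro i j
  by_cases h : i = j
  · subst h
    rw [hf, one_pow]
  · rw [show M i j = 0 from huniv i j h, pow_zero]

namespace CoxeterSystem

/-! ### Unique descents in universal Coxeter systems -/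

open Classical in
/-- Prepend a letter to a word, cancelling it against an equal first letter. -/
def consReduce (i : B) : List B → List B
  | [] => [i]
  | j :: l => if i = j then l else i :: j :: l

theorem consReduce_isChain (i : B) {l : List B} (hl : l.IsChain (· ≠ ·)) :
    (consReduce i l).IsChain (· ≠ ·) := by
  cases l with
  | nil => simp [consReduce]
  | cons j l =>
    rw [consReduce]
    split_ifs with h
    · exact hl.tail
    · exact List.isChain_cons_cons.2 ⟨h, hl⟩

theorem consReduce_consReduce (i : B) {l : List B} (hl : l.IsChain (· ≠ ·)) :
    consReduce i (consReduce i l) = l := by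
  cases l with
  | nil => simp [consReduce]
  | cons j l =>
    by_cases h : i = j
    · subst h
      cases l with
      | nil => simp [consReduce]
      | cons k l =>
        have := (List.isChain_cons_cons.1 hl).1
        simp [consReduce, this]
    · simp [consReduce, h]

theorem wordProd_consReduce (cs : CoxeterSystem M W) (i : B) (l : List B) :
    cs.wordProd (consReduce i l) = cs.simple i * cs.wordProd l := by
  cases l with
  | nil => simp [consReduce]
  | cons j l =>
    by_cases h : i = j
    · subst h
      simp [consReduce, wordProd_cons]
    · simp [consReduce, h, wordProd_cons]

theorem length_consReduce_le (i : B) (l : List B) :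
    (consReduce i l).length ≤ l.length + 1 := by
  cases l with
  | nil => simp [consReduce]
  | cons j l =>
    rw [consReduce]
    split_ifs
    · rw [List.length_cons]
      omega
    · rfl

/-- The permutation of the words without equal adjacent letters given by `consReduce`. -/
def consReducePerm (i : B) : Equiv.Perm {l : List B // l.IsChain (· ≠ ·)} :=
  Function.Involutive.toPerm (fun l => ⟨consReduce i l.1, consReduce_isChain i l.2⟩)
    fun l => Subtype.ext (consReduce_consReduce i l.2)

/-- In a universal Coxeter system every element has a normal form. -/
theorem exists_normalForm (cs : CoxeterSystem M W) (huniv : ∀ i j : B, i ≠ j → M.M i j = 0) :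
    ∃ N : W → List B, (∀ w i, N (cs.simple i * w) = consReduce i (N w)) ∧
      ∀ w, (N w).length = cs.length w := by
  have hl : M.IsLiftable (consReducePerm (B := B)) :=
    M.isLiftable_of_universal huniv fun i =>
      Equiv.ext fun l => Subtype.ext (consReduce_consReduce i l.2)
  let N : W → List B := fun w => (cs.lift ⟨_, hl⟩ w ⟨[], List.isChain_nil⟩).1
  have hN : ∀ w i, N (cs.simple i * w) = consReduce i (N w) := by
    intro w i
    simp only [N, map_mul, cs.lift_apply_simple hl]
    rfl
  have hN1 : N 1 = [] := by simp [N]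
  refine ⟨N, hN, fun w => le_antisymm ?_ ?_⟩
  · obtain ⟨ω, hω, rfl⟩ := cs.exists_isReduced w
    rw [hω.eq]
    clear hω
    induction ω with
    | nil => simp [hN1]
    | cons i ω ih =>
      rw [wordProd_cons, hN]
      exact (length_consReduce_le _ _).trans (by simpa using ih)
  · have : cs.wordProd (N w) = w := by
      induction w using cs.simple_induction_left with
      | one => simp [hN1]
      | mul_simple_left w i ih => rw [hN, wordProd_consReduce, ih]
    conv_lhs => rw [← this]
    exact cs.length_wordProd_le _

theorem leftDescent_unique (cs : CoxeterSystem M W) (huniv : ∀ i j : B, i ≠ j → M.M i j = 0)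
    {w : W} {i j : B} (hi : cs.IsLeftDescent w i) (hj : cs.IsLeftDescent w j) : i = j := by
  obtain ⟨N, hN, hlen⟩ := cs.exists_normalForm huniv
  have key : ∀ k, cs.IsLeftDescent w k → (N w).head? = some k := by
    intro k hk
    rw [IsLeftDescent, ← hlen, ← hlen, hN] at hk
    cases h : N w with
    | nil => simp [h] at hk
    | cons m l =>
      by_contra hne
      have : k ≠ m := by simpa [eq_comm] using hne
      simp [h, consReduce, this] at hk
  exact Option.some_injective _ ((key i hi).symm.trans (key j hj))

theorem rightDescent_unique (cs : CoxeterSystem M W) (huniv : ∀ i j : B, i ≠ j → M.M i j = 0)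
    {w : W} {i j : B} (hi : cs.IsRightDescent w i) (hj : cs.IsRightDescent w j) : i = j :=
  cs.leftDescent_unique huniv (cs.isLeftDescent_inv_iff.2 hi) (cs.isLeftDescent_inv_iff.2 hj)

theorem simple_injective_of_universal (cs : CoxeterSystem M W)
    (huniv : ∀ i j : B, i ≠ j → M.M i j = 0) : Function.Injective cs.simple := by
  intro i j h
  refine cs.leftDescent_unique huniv (w := cs.simple i) ?_ ?_
  · simp [IsLeftDescent]
  · rw [h]
    simp [IsLeftDescent]

/-- Multiplying up on the left preserves right descents. -/
theorem IsRightDescent.simple_mul {cs : CoxeterSystem M W} {w : W} {i j : B}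
    (hj : cs.IsRightDescent w j) (hi : ¬ cs.IsLeftDescent w i) :
    cs.IsRightDescent (cs.simple i * w) j := by
  have h1 := cs.isRightDescent_iff.1 hj
  have h2 := cs.not_isLeftDescent_iff.1 hi
  have h3 := cs.length_mul_le (cs.simple i) (w * cs.simple j)
  rw [← mul_assoc, length_simple] at h3
  unfold IsRightDescent
  omega

/-! ### The reflection cocycle in universal Coxeter systems -/

open Classical in
/-- Conjugation by a simple reflection on signed elements, changing the sign of that reflection. -/
def signedConj (cs : CoxeterSystem M W) (i : B) : Equiv.Perm (W × Bool) :=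
  Function.Involutive.toPerm
    (fun p => (cs.simple i * p.1 * cs.simple i, xor p.2 (decide (p.1 = cs.simple i)))) <| by
    rintro ⟨t, b⟩
    have : cs.simple i * t * cs.simple i = cs.simple i ↔ t = cs.simple i := by
      rw [mul_eq_right, ← cs.simple_mul_simple_self i, mul_right_inj]
    simp [← mul_assoc, this]

open Classical in
theorem signedConj_apply (cs : CoxeterSystem M W) (i : B) (p : W × Bool) :
    cs.signedConj i p =
      (cs.simple i * p.1 * cs.simple i, xor p.2 (decide (p.1 = cs.simple i))) :=
  rfl

theorem signedConj_mul_self (cs : CoxeterSystem M W) (i : B) :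
    cs.signedConj i * cs.signedConj i = 1 :=
  Equiv.ext (Function.Involutive.toPerm_involutive _)

theorem signedConj_self (cs : CoxeterSystem M W) (i : B) (b : Bool) :
    cs.signedConj i (cs.simple i, b) = (cs.simple i, !b) := by
  simp [signedConj_apply]

theorem signedConj_of_ne (cs : CoxeterSystem M W) {i : B} {t : W} (h : t ≠ cs.simple i)
    (b : Bool) : cs.signedConj i (t, b) = (cs.simple i * t * cs.simple i, b) := by
  simp [signedConj_apply, h]

theorem length_simple_mul_reflection_mul_lt (cs : CoxeterSystem M W)
    (huniv : ∀ i j : B, i ≠ j → M.M i j = 0) {r y : W} {i : B} (hr : cs.IsReflection r)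
    (hri : r ≠ cs.simple i) (h : cs.length (r * y) < cs.length y) :
    cs.length (cs.simple i * (r * y)) < cs.length (cs.simple i * y) := by
  have hl : M.IsLiftable cs.signedConj :=
    M.isLiftable_of_universal huniv cs.signedConj_mul_self
  let φ := cs.lift ⟨_, hl⟩
  have hφ : ∀ j, φ (cs.simple j) = cs.signedConj j := cs.lift_apply_simple hl
  have hfst : ∀ w p, (φ w p).1 = w * p.1 * w⁻¹ := by
    intro w
    induction w using cs.simple_induction_left with
    | one => simp
    | mul_simple_left w j ih =>
      intro p
      rw [map_mul, Equiv.Perm.mul_apply, hφ]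
      simp [signedConj_apply, ih, mul_assoc]
  have hflip : ∀ w p, φ w (p.1, !p.2) = ((φ w p).1, !(φ w p).2) := by
    intro w
    induction w using cs.simple_induction_left with
    | one => simp
    | mul_simple_left w j ih =>
      intro p
      rw [map_mul, Equiv.Perm.mul_apply, hφ, ih]
      simp [signedConj_apply]
  have hmem : ∀ (ω : List B) (t : W) (b : Bool),
      (φ (cs.wordProd ω)⁻¹ (t, b)).2 ≠ b → t ∈ cs.leftInvSeq ω := by
    intro ω
    induction ω with
    | nil => simp
    | cons j ω ih =>
      intro t b hb
      rw [leftInvSeq, List.mem_cons]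
      by_cases ht : t = cs.simple j
      · exact Or.inl ht
      · right
        rw [wordProd_cons, mul_inv_rev, map_mul, Equiv.Perm.mul_apply, inv_simple, hφ,
          signedConj_of_ne _ ht] at hb
        exact List.mem_map.2 ⟨_, ih _ _ hb, by simp [mul_assoc]⟩
  have hself : ∀ t, cs.IsReflection t → φ t (t, false) = (t, true) := by
    rintro t ⟨w, j, rfl⟩
    have h1 : ∀ b, φ w (cs.simple j, b) = (w * cs.simple j * w⁻¹, (φ w (cs.simple j, b)).2) :=
      fun b => Prod.ext (hfst _ _) rfl
    obtain ⟨b, hb⟩ : ∃ b, φ w (cs.simple j, b) = (w * cs.simple j * w⁻¹, false) := by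
      cases hc : (φ w (cs.simple j, false)).2 with
      | false => exact ⟨false, by rw [h1, hc]⟩
      | true => exact ⟨true, by simpa [hc, hfst] using hflip w (cs.simple j, false)⟩
    have hb' : φ w⁻¹ (w * cs.simple j * w⁻¹, false) = (cs.simple j, b) := by
      rw [← hb, ← Equiv.Perm.mul_apply, ← map_mul]
      simp
    rw [map_mul, map_mul, Equiv.Perm.mul_apply, Equiv.Perm.mul_apply, hb', hφ, signedConj_self]
    have := hflip w (cs.simple j, b)
    rw [hb] at this
    exact this
  have hpos : ∀ t w, cs.IsReflection t → (φ w⁻¹ (t, false)).2 = true →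
      cs.length (t * w) < cs.length w := by
    intro t w ht hs
    obtain ⟨ω, hω, rfl⟩ := cs.exists_isReduced w
    exact (cs.isLeftInversion_of_mem_leftInvSeq hω (hmem ω t false (by rw [hs]; decide))).2
  have hsign : (φ y⁻¹ (r, false)).2 = true := by
    by_contra hc
    have h2 : (φ (r * y)⁻¹ (r, false)).2 = true := by
      have := hflip y⁻¹ (r, false)
      simp only [Bool.not_false] at this
      rw [mul_inv_rev, hr.inv, map_mul, Equiv.Perm.mul_apply, hself r hr, this]
      simpa using hc
    have := hpos r (r * y) hr h2
    rw [← mul_assoc, hr.mul_self, one_mul] at this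
    omega
  have hr' : cs.IsReflection (cs.simple i * r * cs.simple i) := by
    simpa using hr.conj (cs.simple i)
  have := hpos _ (cs.simple i * y) hr' <| by
    have hne : cs.simple i * r * cs.simple i ≠ cs.simple i := by
      rwa [Ne, mul_eq_right, ← cs.simple_mul_simple_self i, mul_right_inj]
    rw [mul_inv_rev, inv_simple, map_mul, Equiv.Perm.mul_apply, hφ, signedConj_of_ne _ hne]
    simpa [mul_assoc] using hsign
  simpa [mul_assoc] using this

end CoxeterSystem

/-! ### Twisted conjugation -/

theorem twConj_one (θ : W ≃* W) (x : W) : twConj θ 1 x = x := by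
  simp [twConj]

theorem twConj_mul (θ : W ≃* W) (v w x : W) :
    twConj θ (v * w) x = twConj θ v (twConj θ w x) := by
  simp [twConj, mul_assoc]

theorem twConj_eq_iff_of_mul_self {θ : W ≃* W} {r : W} (hr : r * r = 1) {x y : W} :
    twConj θ r x = y ↔ x = twConj θ r y := by
  constructor <;> rintro rfl <;> rw [← twConj_mul, hr, twConj_one]

theorem IsTwClass.twConj_mem {θ : W ≃* W} {𝒦 : Set W} (hK : IsTwClass θ 𝒦) {x : W}
    (hx : x ∈ 𝒦) (w : W) : twConj θ w x ∈ 𝒦 := by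
  obtain ⟨x₀, rfl⟩ := hK
  obtain ⟨v, rfl⟩ := hx
  exact ⟨w * v, twConj_mul θ w v x₀⟩

theorem IsTwClass.exists_twConj_eq {θ : W ≃* W} {𝒦 : Set W} (hK : IsTwClass θ 𝒦) {x y : W}
    (hx : x ∈ 𝒦) (hy : y ∈ 𝒦) : ∃ w, twConj θ w x = y := by
  obtain ⟨x₀, rfl⟩ := hK
  obtain ⟨v, rfl⟩ := hx
  obtain ⟨w, rfl⟩ := hy
  exact ⟨w * v⁻¹, by simp [← twConj_mul]⟩

theorem SimpleOnto.exists_simple {cs : CoxeterSystem M W} {θ : W ≃* W} (hθ : SimpleOnto cs θ)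
    (i : B) : ∃ j, θ (cs.simple i) = cs.simple j := by
  have : θ (cs.simple i) ∈ Set.range cs.simple := hθ ▸ Set.mem_image_of_mem θ ⟨i, rfl⟩
  exact this.imp fun _ h => h.symm

theorem SimpleOnto.length_le {cs : CoxeterSystem M W} {θ : W ≃* W} (hθ : SimpleOnto cs θ)
    (w : W) : cs.length (θ w) ≤ cs.length w := by
  obtain ⟨ω, hω, rfl⟩ := cs.exists_isReduced w
  rw [hω.eq]
  clear hω
  induction ω with
  | nil => simp
  | cons i ω ih =>
    obtain ⟨j, hj⟩ := hθ.exists_simple i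
    have := cs.length_mul_le (cs.simple j) (θ (cs.wordProd ω))
    rw [cs.length_simple] at this
    rw [cs.wordProd_cons, map_mul, hj, List.length_cons]
    omega

theorem SimpleOnto.length_eq {cs : CoxeterSystem M W} {θ : W ≃* W} (hθ : SimpleOnto cs θ)
    (hθ2 : ∀ w, θ (θ w) = w) (w : W) : cs.length (θ w) = cs.length w :=
  (hθ.length_le w).antisymm (by simpa [hθ2] using hθ.length_le (θ w))

theorem SimpleOnto.twConj_simple {cs : CoxeterSystem M W} {θ : W ≃* W} (hθ : SimpleOnto cs θ)
    (i : B) : ∃ j, θ (cs.simple i) = cs.simple j ∧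
      ∀ x, twConj θ (cs.simple i) x = cs.simple i * x * cs.simple j := by
  obtain ⟨j, hj⟩ := hθ.exists_simple i
  exact ⟨j, hj, fun x => by rw [twConj, hj, cs.inv_simple]⟩

theorem SimpleOnto.length_twConj_le {cs : CoxeterSystem M W} {θ : W ≃* W} (hθ : SimpleOnto cs θ)
    (w x : W) : cs.length (twConj θ w x) ≤ cs.length x + 2 * cs.length w := by
  have h1 := cs.length_mul_le (w * x) (θ w)⁻¹
  have h2 := cs.length_mul_le w x
  have h3 := hθ.length_le w
  rw [cs.length_inv] at h1
  unfold twConj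
  omega

/-- For a twisted involution, the left and right descents correspond under `θ`. -/
theorem isRightDescent_iff_of_twisted_involution {cs : CoxeterSystem M W} {θ : W ≃* W}
    (hθ : SimpleOnto cs θ) (hθ2 : ∀ w, θ (θ w) = w) {x : W} (hx : θ x = x⁻¹) {i j : B}
    (hij : θ (cs.simple i) = cs.simple j) : cs.IsRightDescent x j ↔ cs.IsLeftDescent x i := by
  have : cs.length (x * cs.simple j) = cs.length (cs.simple i * x) := by
    rw [← hθ.length_eq hθ2, map_mul, hx, ← hij, hθ2, ← cs.length_inv]
    simp
  rw [CoxeterSystem.IsRightDescent, CoxeterSystem.IsLeftDescent, this]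

section Universal

variable {cs : CoxeterSystem M W} {θ : W ≃* W}

theorem length_twConj_simple_of_not_isLeftDescent (huniv : ∀ i j : B, i ≠ j → M.M i j = 0)
    (hθ : SimpleOnto cs θ) (hθ2 : ∀ w, θ (θ w) = w) {x : W} (hx : θ x = x⁻¹) {i : B}
    (hi : ¬ cs.IsLeftDescent x i) (hx1 : x ≠ 1) :
    cs.length (twConj θ (cs.simple i) x) = cs.length x + 2 := by
  obtain ⟨j, hij, hconj⟩ := hθ.twConj_simple i
  have hj : ¬ cs.IsRightDescent x j := by
    rwa [isRightDescent_iff_of_twisted_involution hθ hθ2 hx hij]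
  have hj' : ¬ cs.IsRightDescent (cs.simple i * x) j := by
    intro h
    obtain ⟨k, hk⟩ := cs.exists_rightDescent_of_ne_one hx1
    exact hj (cs.rightDescent_unique huniv h (hk.simple_mul hi) ▸ hk)
  rw [hconj, cs.not_isRightDescent_iff.1 hj', cs.not_isLeftDescent_iff.1 hi]

/-- A simple reflection fixes a twisted involution or changes its length by two. -/
theorem twConj_simple_trichotomy (huniv : ∀ i j : B, i ≠ j → M.M i j = 0)
    (hθ : SimpleOnto cs θ) (hθ2 : ∀ w, θ (θ w) = w) {x : W} (hx : θ x = x⁻¹) (i : B) :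
    twConj θ (cs.simple i) x = x ∨
      (cs.IsLeftDescent x i ∧ cs.length (twConj θ (cs.simple i) x) + 2 = cs.length x) ∨
      (¬ cs.IsLeftDescent x i ∧ cs.length (twConj θ (cs.simple i) x) = cs.length x + 2) := by
  obtain ⟨j, hij, hconj⟩ := hθ.twConj_simple i
  have hdesc := isRightDescent_iff_of_twisted_involution hθ hθ2 hx hij
  by_cases hi : cs.IsLeftDescent x i
  · have hj := hdesc.2 hi
    have hi' := cs.isLeftDescent_iff.1 hi
    by_cases h : cs.IsRightDescent (cs.simple i * x) j
    · have := cs.isRightDescent_iff.1 h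
      rw [hconj]
      exact Or.inr (Or.inl ⟨hi, by omega⟩)
    · left
      have hsx : cs.simple i * x = 1 := by
        by_contra hne
        obtain ⟨k, hk⟩ := cs.exists_rightDescent_of_ne_one hne
        have hk' := hk.simple_mul (cs.isLeftDescent_iff_not_isLeftDescent_mul.1 hi)
        rw [cs.simple_mul_simple_cancel_left] at hk'
        exact h (cs.rightDescent_unique huniv hj hk' ▸ hk)
      have hxi : x = cs.simple i := by
        rw [← cs.inv_simple i]
        exact eq_inv_of_mul_eq_one_right hsx
      have hxj : cs.simple j = x := by
        rw [← hij, ← hxi, hx, hxi, cs.inv_simple]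
      rw [hconj, hsx, one_mul, hxj]
  · by_cases hx1 : x = 1
    · subst hx1
      rw [hconj, mul_one]
      by_cases h : i = j
      · left
        rw [h, cs.simple_mul_simple_self]
      · refine Or.inr (Or.inr ⟨hi, ?_⟩)
        have : ¬ cs.IsRightDescent (cs.simple i) j := fun hd =>
          h (cs.rightDescent_unique huniv (by simp [CoxeterSystem.IsRightDescent]) hd)
        rw [cs.not_isRightDescent_iff.1 this, cs.length_simple, cs.length_one]
    · exact Or.inr (Or.inr ⟨hi,
        length_twConj_simple_of_not_isLeftDescent huniv hθ hθ2 hx hi hx1⟩)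

/-- Once the length goes up, it keeps going up along reduced words. -/
theorem length_twConj_simple_twConj_simple (huniv : ∀ i j : B, i ≠ j → M.M i j = 0)
    (hθ : SimpleOnto cs θ) (hθ2 : ∀ w, θ (θ w) = w) {x : W} {i j : B} (hij : i ≠ j)
    (hx : θ (twConj θ (cs.simple i) x) = (twConj θ (cs.simple i) x)⁻¹)
    (hup : cs.length (twConj θ (cs.simple i) x) = cs.length x + 2) :
    cs.length (twConj θ (cs.simple j) (twConj θ (cs.simple i) x)) = cs.length x + 4 := by
  have hback : twConj θ (cs.simple i) (twConj θ (cs.simple i) x) = x :=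
    (twConj_eq_iff_of_mul_self (cs.simple_mul_simple_self i)).2 rfl
  have hi : cs.IsLeftDescent (twConj θ (cs.simple i) x) i := by
    rcases twConj_simple_trichotomy huniv hθ hθ2 hx i with h | h | h
    · rw [hback] at h
      rw [← h] at hup
      omega
    · exact h.1
    · rw [hback] at h
      omega
  rw [length_twConj_simple_of_not_isLeftDescent huniv hθ hθ2 hx
    (fun hj => hij (cs.leftDescent_unique huniv hi hj)), hup]
  intro h1
  rw [h1, cs.length_one] at hup
  omega

/-- If the last letter of `v` moves a minimal element `x`, then `v` acts on `x` without loss of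
length. -/
theorem length_twConj_of_isRightDescent (huniv : ∀ i j : B, i ≠ j → M.M i j = 0)
    (hθ : SimpleOnto cs θ) (hθ2 : ∀ w, θ (θ w) = w) {x : W}
    (htw : ∀ w, θ (twConj θ w x) = (twConj θ w x)⁻¹) {i : B}
    (hup : cs.length (twConj θ (cs.simple i) x) = cs.length x + 2) {v : W}
    (hv : cs.IsRightDescent v i) : cs.length (twConj θ v x) = cs.length x + 2 * cs.length v := by
  induction hn : cs.length v generalizing v with
  | zero =>
    rw [cs.length_eq_zero_iff.1 hn] at hv
    exact absurd hv (cs.not_isRightDescent_one i)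
  | succ n ih =>
    obtain ⟨j, hj⟩ := cs.exists_leftDescent_of_ne_one (w := v) (by rintro rfl; simp at hn)
    obtain ⟨u, rfl⟩ : ∃ u, v = cs.simple j * u :=
      ⟨cs.simple j * v, (cs.simple_mul_simple_cancel_left j).symm⟩
    have hju : ¬ cs.IsLeftDescent u j := by
      rw [cs.isLeftDescent_iff_not_isLeftDescent_mul, cs.simple_mul_simple_cancel_left] at hj
      exact hj
    have hlen := cs.not_isLeftDescent_iff.1 hju
    by_cases hu : u = 1
    · subst hu
      have : j = i := cs.rightDescent_unique huniv (by simp [CoxeterSystem.IsRightDescent]) hv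
      rw [mul_one, cs.length_simple] at hn
      rw [mul_one, this, hup]
      omega
    obtain ⟨k, hk⟩ := cs.exists_rightDescent_of_ne_one hu
    obtain rfl := cs.rightDescent_unique huniv (hk.simple_mul hju) hv
    have ihu := ih hk (by omega)
    obtain ⟨l, hl⟩ := cs.exists_leftDescent_of_ne_one hu
    have hlj : l ≠ j := fun h => hju (h ▸ hl)
    obtain ⟨t, rfl⟩ : ∃ t, u = cs.simple l * t :=
      ⟨cs.simple l * u, (cs.simple_mul_simple_cancel_left l).symm⟩
    have hlt := cs.isLeftDescent_iff.1 hl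
    rw [cs.simple_mul_simple_cancel_left] at hlt
    have hle := hθ.length_twConj_le t x
    have hle' := hθ.length_twConj_le (cs.simple l) (twConj θ t x)
    rw [cs.length_simple] at hle'
    have htw' := htw (cs.simple l * t)
    rw [twConj_mul] at htw' ihu
    rw [twConj_mul, twConj_mul,
      length_twConj_simple_twConj_simple huniv hθ hθ2 hlj htw' (by omega)]
    omega

theorem length_reflection_mul_mul_simple_lt (huniv : ∀ i j : B, i ≠ j → M.M i j = 0)
    {t w : W} {i : B} (ht : cs.IsReflection t) (hne : t * w ≠ w * cs.simple i)
    (hlt : cs.length (t * w) < cs.length w) :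
    cs.length (t * (w * cs.simple i)) < cs.length (w * cs.simple i) := by
  have hconj : cs.IsReflection (w⁻¹ * t * w) := by simpa using ht.conj w⁻¹
  have key := cs.length_simple_mul_reflection_mul_lt huniv (y := w⁻¹) (i := i) hconj ?_ ?_
  · rw [← cs.length_inv, ← cs.length_inv (w * cs.simple i)]
    simpa [mul_assoc, ht.inv] using key
  · intro h
    exact hne (by rw [← h]; group)
  · rw [← cs.length_inv, ← cs.length_inv w⁻¹]
    simpa [mul_assoc, ht.inv] using hlt

/-- In the orbit of a minimal element `x`, an inversion of `w` not fixing `w • x` decreases its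
length. -/
theorem length_twConj_lt_of_length_lt (huniv : ∀ i j : B, i ≠ j → M.M i j = 0)
    (hθ : SimpleOnto cs θ) (hθ2 : ∀ w, θ (θ w) = w) {x : W}
    (htw : ∀ w, θ (twConj θ w x) = (twConj θ w x)⁻¹) (hmin : TwMin cs θ x)
    {r w : W} (hr : cs.IsReflection r) (hfix : twConj θ r (twConj θ w x) ≠ twConj θ w x)
    (hlt : cs.length (r * w) < cs.length w) :
    cs.length (twConj θ r (twConj θ w x)) < cs.length (twConj θ w x) := by
  induction hn : cs.length w generalizing w with
  | zero => omega
  | succ n ih =>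
    obtain ⟨i, hi⟩ := cs.exists_rightDescent_of_ne_one (w := w) (by rintro rfl; simp at hn)
    have hx := htw 1
    rw [twConj_one] at hx
    have hle := hmin i
    rcases twConj_simple_trichotomy huniv hθ hθ2 hx i with h | h | h
    · have hw : twConj θ (w * cs.simple i) x = twConj θ w x := by rw [twConj_mul, h]
      have hne : r * w ≠ w * cs.simple i := by
        intro h'
        exact hfix (by rw [← twConj_mul, h', hw])
      have := ih (w := w * cs.simple i) (by rwa [hw])
        (length_reflection_mul_mul_simple_lt huniv hr hne hlt)
        (by have := cs.isRightDescent_iff.1 hi; omega)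
      rwa [hw] at this
    · omega
    · have h1 := length_twConj_of_isRightDescent huniv hθ hθ2 htw h.2 hi
      have h2 := hθ.length_twConj_le (r * w) x
      rw [← twConj_mul]
      omega

/-- In the orbit of a minimal element `x`, a non-inversion of `w` not fixing `w • x` increases its
length. -/
theorem length_lt_length_twConj_of_length_lt (huniv : ∀ i j : B, i ≠ j → M.M i j = 0)
    (hθ : SimpleOnto cs θ) (hθ2 : ∀ w, θ (θ w) = w) {x : W}
    (htw : ∀ w, θ (twConj θ w x) = (twConj θ w x)⁻¹) (hmin : TwMin cs θ x)
    {r w : W} (hr : cs.IsReflection r) (hfix : twConj θ r (twConj θ w x) ≠ twConj θ w x)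
    (hlt : cs.length w < cs.length (r * w)) :
    cs.length (twConj θ w x) < cs.length (twConj θ r (twConj θ w x)) := by
  have hback : twConj θ r (twConj θ r (twConj θ w x)) = twConj θ w x :=
    (twConj_eq_iff_of_mul_self hr.mul_self).2 rfl
  have := length_twConj_lt_of_length_lt huniv hθ hθ2 htw hmin (w := r * w) hr
    (by rw [twConj_mul, hback]; exact hfix.symm)
    (by rwa [← mul_assoc, hr.mul_self, one_mul])
  rwa [twConj_mul, hback] at this

end Universal

/-- Suppose `(W,S)` is universal. If `θ` is an involutive automorphism
preserving `S` and `𝒦` is a `θ`-twisted conjugacy class consisting of twisted involutions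
(`θ(x) = x⁻¹` for all `x ∈ 𝒦`), then `𝒦` is quasiparabolic. -/
theorem stmt18 (cs : CoxeterSystem M W) (huniv : ∀ i j : B, i ≠ j → M.M i j = 0)
    (θ : W ≃* W) (hθS : SimpleOnto cs θ) (hθ2 : ∀ w : W, θ (θ w) = w)
    (𝒦 : Set W) (hK : IsTwClass θ 𝒦) (htw : ∀ x ∈ 𝒦, θ x = x⁻¹) :
    IsQPClass cs θ 𝒦 := by
  obtain ⟨x₀, hx₀, hle⟩ : ∃ x₀ ∈ 𝒦, ∀ y ∈ 𝒦, cs.length x₀ ≤ cs.length y := by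
    have hne : 𝒦.Nonempty := by
      obtain ⟨x, rfl⟩ := hK
      exact Set.range_nonempty _
    exact ⟨_, Function.argminOn_mem cs.length 𝒦 hne,
      fun y hy => Function.argminOn_le cs.length 𝒦 hy⟩
  have htw₀ : ∀ w, θ (twConj θ w x₀) = (twConj θ w x₀)⁻¹ := fun w => htw _ (hK.twConj_mem hx₀ w)
  have hmin : TwMin cs θ x₀ := fun i => hle _ (hK.twConj_mem hx₀ _)
  have ht : ∀ x y, htL cs x < htL cs y ↔ cs.length x < cs.length y := fun x y => by
    rw [htL, htL, div_lt_div_iff_of_pos_right two_pos, Nat.cast_lt]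
  refine ⟨fun r hr x hx heq => ?_, fun r hr x hx i hlt hlt' => ?_⟩ <;>
    obtain ⟨w, rfl⟩ := hK.exists_twConj_eq hx₀ hx
  · by_contra hfix
    rcases lt_or_gt_of_ne (hr.length_mul_right_ne w) with h | h
    · have := length_twConj_lt_of_length_lt huniv hθS hθ2 htw₀ hmin hr hfix h
      exact ((ht _ _).2 this).ne heq
    · have := length_lt_length_twConj_of_length_lt huniv hθS hθ2 htw₀ hmin hr hfix h
      exact ((ht _ _).2 this).ne' heq
  · rw [ht] at hlt hlt'
    by_contra hne
    have hri : r ≠ cs.simple i := fun h => hne (by rw [h])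
    have hfix : twConj θ r (twConj θ w x₀) ≠ twConj θ w x₀ := fun h => hlt.ne (by rw [h])
    have hup : cs.length w < cs.length (r * w) := by
      refine lt_of_le_of_ne (not_lt.1 fun h => ?_) (hr.length_mul_right_ne w).symm
      exact hlt.asymm (length_twConj_lt_of_length_lt huniv hθS hθ2 htw₀ hmin hr hfix h)
    have hup' : cs.length (cs.simple i * w) < cs.length (cs.simple i * (r * w)) := by
      have := cs.length_simple_mul_reflection_mul_lt huniv (y := r * w) hr hri
        (by rwa [← mul_assoc, hr.mul_self, one_mul])
      rwa [← mul_assoc r, hr.mul_self, one_mul] at this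
    have hmul : cs.simple i * r * cs.simple i * (cs.simple i * w) = cs.simple i * (r * w) := by
      simp [mul_assoc]
    have hact : twConj θ (cs.simple i * r * cs.simple i) (twConj θ (cs.simple i * w) x₀) =
        twConj θ (cs.simple i) (twConj θ r (twConj θ w x₀)) := by
      rw [← twConj_mul, hmul, twConj_mul, twConj_mul]
    have := length_lt_length_twConj_of_length_lt huniv hθS hθ2 htw₀ hmin
      (r := cs.simple i * r * cs.simple i) (w := cs.simple i * w)
      (by simpa using hr.conj (cs.simple i))
      (by
        rw [hact, twConj_mul]
        exact fun h => hlt'.ne (by rw [h]))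
      (by rwa [hmul])
    rw [hact, twConj_mul] at this
    exact hlt'.asymm this

end
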